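/- Let n ≥ 4, let G = SL(n, ℝ) (the group of real n×n matrices of determinant 1, with the matrix topology), and let H ≤ G be the image of SL(2, ℝ) embedded in the upper left corner, i.e. the subgroup of block matrices diag(B, I_{n−2}) with B ∈ SL(2, ℝ). Then the homogeneous space G/H (with the quotient topology and the left translation action) admits no compact quotient: there is no discrete subgroup Γ ≤ G whose left translation action on G/H is properly discontinuous and such that there exists a compact set C ⊆ G/H with Γ·C = G/H. The same statement holds with ℝ replaced by ℂ. -/

import Mathlib

noncomputable section

/-- A matrix agrees with the identity outside its upper-left `2 × 2` block. -/
def Pblock {n : ℕ} {R : Type*} [CommRing R] (A : Matrix (Fin n) (Fin n) R) : Prop :=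
  ∀ i j : Fin n, 2 ≤ (i : ℕ) ∨ 2 ≤ (j : ℕ) → A i j = if i = j then 1 else 0

lemma Pblock.one {n : ℕ} {R : Type*} [CommRing R] :
    Pblock (1 : Matrix (Fin n) (Fin n) R) := fun _ _ _ => Matrix.one_apply

lemma rowP {n : ℕ} {R : Type*} [CommRing R] {A B : Matrix (Fin n) (Fin n) R}
    (hA : Pblock A) (hAB : A * B = 1) {i j : Fin n} (hi : 2 ≤ (i : ℕ)) :
    B i j = if i = j then 1 else 0 := by
  have h2 : B i j = (A * B) i j := by
    rw [Matrix.mul_apply]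
    have h : ∀ k, A i k * B k j = if i = k then B k j else 0 := by
      intro k
      rw [hA i k (Or.inl hi)]
      by_cases h : i = k <;> simp [h]
    rw [Finset.sum_congr rfl fun k _ => h k, Finset.sum_ite_eq]
    simp
  rw [h2, hAB, Matrix.one_apply]

lemma colP {n : ℕ} {R : Type*} [CommRing R] {A B : Matrix (Fin n) (Fin n) R}
    (hA : Pblock A) (hBA : B * A = 1) {i j : Fin n} (hj : 2 ≤ (j : ℕ)) :
    B i j = if i = j then 1 else 0 := by
  have h2 : B i j = (B * A) i j := by
    rw [Matrix.mul_apply]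
    have h : ∀ k, B i k * A k j = if k = j then B i k else 0 := by
      intro k
      rw [hA k j (Or.inr hj)]
      by_cases h : k = j <;> simp [h]
    rw [Finset.sum_congr rfl fun k _ => h k, Finset.sum_ite_eq']
    simp
  rw [h2, hBA, Matrix.one_apply]

lemma Pblock.mul {n : ℕ} {R : Type*} [CommRing R] {A B : Matrix (Fin n) (Fin n) R}
    (hA : Pblock A) (hB : Pblock B) : Pblock (A * B) := by
  intro i j hij
  rw [Matrix.mul_apply]
  rcases hij with hi | hj
  · have h : ∀ k, A i k * B k j = if i = k then B k j else 0 := by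
      intro k
      rw [hA i k (Or.inl hi)]
      by_cases h : i = k <;> simp [h]
    rw [Finset.sum_congr rfl fun k _ => h k, Finset.sum_ite_eq]
    simp [hB i j (Or.inl hi)]
  · have h : ∀ k, A i k * B k j = if k = j then A i k else 0 := by
      intro k
      rw [hB k j (Or.inr hj)]
      by_cases h : k = j <;> simp [h]
    rw [Finset.sum_congr rfl fun k _ => h k, Finset.sum_ite_eq']
    simp [hA i j (Or.inr hj)]

/-- The copy of `SL₂` embedded in the upper left corner of `SL_n`:
block matrices `diag(B, I_{n-2})`. -/
def sl2Block (n : ℕ) (R : Type*) [CommRing R] :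
    Subgroup (Matrix.SpecialLinearGroup (Fin n) R) where
  carrier := {g | Pblock (g : Matrix (Fin n) (Fin n) R)}
  one_mem' := by
    simpa using Pblock.one (n := n) (R := R)
  mul_mem' := by
    intro a b ha hb
    simpa using Pblock.mul ha hb
  inv_mem' := by
    intro a ha
    have h1 : (a : Matrix (Fin n) (Fin n) R) *
        ((a⁻¹ : Matrix.SpecialLinearGroup (Fin n) R) : Matrix (Fin n) (Fin n) R) = 1 := by
      rw [← Matrix.SpecialLinearGroup.coe_mul, mul_inv_cancel, Matrix.SpecialLinearGroup.coe_one]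
    have h2 : ((a⁻¹ : Matrix.SpecialLinearGroup (Fin n) R) : Matrix (Fin n) (Fin n) R) *
        (a : Matrix (Fin n) (Fin n) R) = 1 := by
      rw [← Matrix.SpecialLinearGroup.coe_mul, inv_mul_cancel, Matrix.SpecialLinearGroup.coe_one]
    intro i j hij
    rcases hij with hi | hj
    · exact rowP ha h1 hi
    · exact colP ha h2 hj

/-- The matrix topology on `SL(n, 𝕜)`. -/
instance (n : ℕ) (𝕜 : Type*) [RCLike 𝕜] :
    TopologicalSpace (Matrix.SpecialLinearGroup (Fin n) 𝕜) :=
  inferInstanceAs (TopologicalSpace {A : Matrix (Fin n) (Fin n) 𝕜 // A.det = 1})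


section TopPart

open Set Metric MeasureTheory Topology
open scoped Manifold ContDiff

lemma det_interp_matrix (m : ℕ) (ε : ℝ) (hε : 0 < ε) :
    ∃ t c : Fin (m+1) → ℝ, (∀ i, 0 ≤ t i ∧ t i ≤ ε) ∧ ∑ i, c i = 1 ∧
      ∀ A : Matrix (Fin m) (Fin m) ℝ, (1 + A).det = ∑ i, c i * (1 + t i • A).det := by
  set v : Fin (m+1) → ℝ := fun i => ε * (i : ℝ) / (m+1) with hv
  have hinj : Function.Injective v := by
    intro i j hij
    simp only [hv] at hij
    have : (i : ℝ) = (j : ℝ) := by field_simp at hij; exact hij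
    exact Fin.ext (by exact_mod_cast this)
  refine ⟨v, fun i => (Lagrange.basis Finset.univ v i).eval 1, ?_, ?_, ?_⟩
  · intro i
    have h1 : (i : ℝ) ≤ m + 1 := by exact_mod_cast i.2.le
    constructor
    · simp only [hv]; positivity
    · simp only [hv]
      rw [div_le_iff₀ (by positivity)]
      gcongr
  · rw [← Polynomial.eval_finsetSum, Lagrange.sum_basis hinj.injOn Finset.univ_nonempty]
    simp
  · intro A
    set q : Polynomial ℝ := Matrix.det ((Polynomial.X : Polynomial ℝ) • A.map Polynomial.C
      + (1 : Matrix (Fin m) (Fin m) ℝ).map Polynomial.C) with hq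
    have hev : ∀ s : ℝ, q.eval s = (1 + s • A).det := by
      intro s
      rw [hq, ← Polynomial.coe_evalRingHom, RingHom.map_det]
      congr 1
      ext i j
      by_cases hij : i = j <;> simp [hij] <;> ring
    have hdeg : q.degree < (Finset.univ : Finset (Fin (m+1))).card := by
      refine lt_of_le_of_lt Polynomial.degree_le_natDegree ?_
      have := Polynomial.natDegree_det_X_add_C_le A 1
      simp only [Fintype.card_fin] at this
      simp only [Finset.card_univ, Fintype.card_fin]
      exact_mod_cast Nat.lt_succ_of_le this
    have := Lagrange.eq_interpolate (hvs := hinj.injOn) hdeg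
    have h2 := congrArg (Polynomial.eval 1) this
    rw [hev, Lagrange.interpolate_apply, Polynomial.eval_finsetSum] at h2
    simp only [one_smul] at h2
    rw [h2]
    refine Finset.sum_congr rfl fun i _ => ?_
    simp [hev, mul_comm]

variable {E : Type*} [NormedAddCommGroup E] [InnerProductSpace ℝ E] [FiniteDimensional ℝ E]

lemma det_interp (E : Type*) [NormedAddCommGroup E] [InnerProductSpace ℝ E] [FiniteDimensional ℝ E]
    (ε : ℝ) (hε : 0 < ε) :
    ∃ (k : ℕ) (t c : Fin k → ℝ), (∀ i, 0 ≤ t i ∧ t i ≤ ε) ∧ ∑ i, c i = 1 ∧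
      ∀ A : E →L[ℝ] E, (ContinuousLinearMap.id ℝ E + A).det
        = ∑ i, c i * (ContinuousLinearMap.id ℝ E + t i • A).det := by
  obtain ⟨t, c, h1, h2, h3⟩ := det_interp_matrix (Module.finrank ℝ E) ε hε
  refine ⟨_, t, c, h1, h2, fun A => ?_⟩
  let b := Module.finBasis ℝ E
  have key : ∀ s : ℝ, (ContinuousLinearMap.id ℝ E + s • A).det
      = (1 + s • LinearMap.toMatrix b b (A : E →ₗ[ℝ] E)).det := by
    intro s
    rw [ContinuousLinearMap.det, ← LinearMap.det_toMatrix b]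
    congr 1
    simp
  have := key 1
  rw [one_smul, one_smul] at this
  rw [this, h3]
  simp [key]

lemma no_smooth_retraction [MeasurableSpace E] [BorelSpace E]
    (r : E → E) (hr : ContDiff ℝ 1 r) (R : ℝ) (hR : 0 < R)
    (h1 : ∀ y, ‖y‖ ≤ R → ‖r y‖ = R) (h2 : ∀ y, ‖y‖ = R → r y = y) : False := by
  set u : E → E := fun y => r y - y with hu
  have hud : ContDiff ℝ 1 u := hr.sub contDiff_id
  have hudiff : Differentiable ℝ u := hud.differentiable (by norm_num)
  have hcf : Continuous (fderiv ℝ u) := hud.continuous_fderiv (by norm_num)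
  obtain ⟨K, hK⟩ := (isCompact_closedBall (0:E) R).exists_bound_of_continuousOn hcf.continuousOn
  have hK0 : 0 ≤ K := le_trans (norm_nonneg _) (hK 0 (by simp [hR.le]))
  set ε : ℝ := 1 / (2 * (K + 1)) with hε
  have hεpos : 0 < ε := by positivity
  have hε1 : ε < 1 := by
    rw [hε, div_lt_one (by positivity)]; linarith
  have hεK : ε * K ≤ 1 / 2 := by
    rw [hε, div_mul_eq_mul_div, div_le_div_iff₀ (by positivity) (by norm_num)]; linarith
  have hlip : ∀ x ∈ closedBall (0:E) R, ∀ y ∈ closedBall (0:E) R, ‖u y - u x‖ ≤ K * ‖y - x‖ := by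
    intro x hx y hy
    exact (convex_closedBall (0:E) R).norm_image_sub_le_of_norm_fderiv_le
      (fun z _ => hudiff z) (fun z hz => hK z hz) hx hy
  -- nonvanishing determinant
  have hdetne : ∀ s : ℝ, 0 ≤ s → s ≤ ε → ∀ x ∈ closedBall (0:E) R,
      LinearMap.ker (ContinuousLinearMap.id ℝ E + s • fderiv ℝ u x : E →L[ℝ] E).toLinearMap = ⊥ := by
    intro s hs0 hs x hx
    rw [LinearMap.ker_eq_bot']
    intro w hw
    have hw' : w + s • (fderiv ℝ u x) w = 0 := by simpa using hw
    have h3 : ‖w‖ = s * ‖(fderiv ℝ u x) w‖ := by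
      have : w = - (s • (fderiv ℝ u x) w) := eq_neg_of_add_eq_zero_left hw'
      conv_lhs => rw [this]
      rw [norm_neg, norm_smul, Real.norm_of_nonneg hs0]
    have h4 : ‖(fderiv ℝ u x) w‖ ≤ K * ‖w‖ := by
      refine ((fderiv ℝ u x).le_opNorm w).trans ?_
      have := hK x hx
      gcongr
    have h5 : ‖w‖ ≤ 1/2 * ‖w‖ := by
      calc ‖w‖ = s * ‖(fderiv ℝ u x) w‖ := h3
        _ ≤ ε * (K * ‖w‖) := by gcongr
        _ = (ε * K) * ‖w‖ := by ring
        _ ≤ 1/2 * ‖w‖ := by gcongr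
    have : ‖w‖ ≤ 0 := by linarith
    exact norm_le_zero_iff.mp this
  have hdetpos : ∀ t : ℝ, 0 ≤ t → t ≤ ε → ∀ x ∈ closedBall (0:E) R,
      0 < (ContinuousLinearMap.id ℝ E + t • fderiv ℝ u x).det := by
    intro t ht0 ht x hx
    by_contra hcon
    push Not at hcon
    have hc : Continuous fun s : ℝ => (ContinuousLinearMap.id ℝ E + s • fderiv ℝ u x).det := by
      exact ContinuousLinearMap.continuous_det.comp (by fun_prop)
    have h0 : (ContinuousLinearMap.id ℝ E + (0:ℝ) • fderiv ℝ u x).det = 1 := by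
      rw [zero_smul, add_zero]
      exact LinearMap.det_id
    have := intermediate_value_Icc' ht0 hc.continuousOn
    obtain ⟨s, hs, hs'⟩ := this ⟨hcon, by rw [h0]; norm_num⟩
    have hk := hdetne s hs.1 (hs.2.trans ht) x hx
    have : LinearMap.det (ContinuousLinearMap.id ℝ E + s • fderiv ℝ u x : E →L[ℝ] E).toLinearMap ≠ 0 := by
      intro h
      exact (LinearMap.bot_lt_ker_of_det_eq_zero h).ne' hk
    exact this hs'
  have hIntg : ∀ t : ℝ, IntegrableOn
      (fun x => (ContinuousLinearMap.id ℝ E + t • fderiv ℝ u x).det) (ball (0:E) R) volume := by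
    intro t
    have hc : Continuous (fun x => (ContinuousLinearMap.id ℝ E + t • fderiv ℝ u x).det) :=
      ContinuousLinearMap.continuous_det.comp (by fun_prop)
    exact (hc.continuousOn.integrableOn_compact (isCompact_closedBall (0:E) R)).mono_set
      ball_subset_closedBall
  have hvol : ∀ t : ℝ, 0 ≤ t → t ≤ ε →
      ∫ x in ball (0:E) R, (ContinuousLinearMap.id ℝ E + t • fderiv ℝ u x).det
        = volume.real (ball (0:E) R) := by
    intro t ht0 ht
    set f : E → E := fun y => y + t • u y with hf
    have hfd : ContDiff ℝ 1 f := contDiff_id.add (hud.const_smul t)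
    have hder : ∀ x, HasFDerivAt f (ContinuousLinearMap.id ℝ E + t • fderiv ℝ u x) x := by
      intro x
      exact (hasFDerivAt_id x).add ((hudiff x).hasFDerivAt.const_smul t)
    have hinj : InjOn f (ball (0:E) R) := by
      intro x hx y hy hxy
      have hl := hlip x (ball_subset_closedBall hx) y (ball_subset_closedBall hy)
      have h3 : y - x = - (t • (u y - u x)) := by
        have : x + t • u x = y + t • u y := hxy
        rw [smul_sub]
        rw [eq_comm, ← sub_eq_zero] at this
        rw [eq_neg_iff_add_eq_zero, ← this]; abel
      have h4 : ‖y - x‖ = t * ‖u y - u x‖ := by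
        conv_lhs => rw [h3]
        rw [norm_neg, norm_smul, Real.norm_of_nonneg ht0]
      have h5 : ‖y - x‖ ≤ 1/2 * ‖y - x‖ := by
        calc ‖y - x‖ = t * ‖u y - u x‖ := h4
          _ ≤ ε * (K * ‖y - x‖) := by gcongr
          _ = (ε * K) * ‖y-x‖ := by ring
          _ ≤ 1/2 * ‖y-x‖ := by gcongr
      have : ‖y - x‖ ≤ 0 := by linarith
      exact (sub_eq_zero.mp (norm_le_zero_iff.mp this)).symm
    have hfeq : ∀ y, f y = (1 - t) • y + t • r y := by
      intro y; simp only [hf, hu]; module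
    have ht1 : t < 1 := ht.trans_lt hε1
    have hmaps : ∀ x ∈ ball (0:E) R, f x ∈ ball (0:E) R := by
      intro x hx
      rw [mem_ball_zero_iff] at hx ⊢
      rw [hfeq]
      calc ‖(1 - t) • x + t • r x‖ ≤ ‖(1-t) • x‖ + ‖t • r x‖ := norm_add_le _ _
        _ = (1 - t) * ‖x‖ + t * R := by
          rw [norm_smul, norm_smul, h1 x hx.le, Real.norm_of_nonneg ht0,
            Real.norm_of_nonneg (by linarith)]
        _ < (1 - t) * R + t * R := by
          have : 0 < 1 - t := by linarith
          gcongr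
        _ = R := by ring
    have hopen : IsOpen (f '' ball (0:E) R) := by
      rw [isOpen_iff_mem_nhds]
      rintro _ ⟨x, hx, rfl⟩
      have hs : HasStrictFDerivAt f (ContinuousLinearMap.id ℝ E + t • fderiv ℝ u x) x :=
        hfd.contDiffAt.hasStrictFDerivAt' (hder x) (by norm_num)
      have hk := hdetne t ht0 ht x (ball_subset_closedBall hx)
      have hsurj : LinearMap.range (ContinuousLinearMap.id ℝ E + t • fderiv ℝ u x : E →L[ℝ] E).toLinearMap = ⊤ :=
        LinearMap.ker_eq_bot_iff_range_eq_top.mp hk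
      rw [← hs.map_nhds_eq_of_surj hsurj]
      exact Filter.image_mem_map (isOpen_ball.mem_nhds hx)
    have himg : f '' ball (0:E) R = ball (0:E) R := by
      apply Subset.antisymm
      · rintro _ ⟨x, hx, rfl⟩; exact hmaps x hx
      · have hcl : IsClosed (f '' closedBall (0:E) R) :=
          ((isCompact_closedBall (0:E) R).image hfd.continuous).isClosed
        apply (convex_ball (0:E) R).isPreconnected.subset_left_of_subset_union hopen
          hcl.isOpen_compl
        · rw [disjoint_compl_right_iff_subset]
          exact image_mono ball_subset_closedBall
        · intro x hx
          by_cases hx' : x ∈ f '' closedBall (0:E) R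
          · left
            obtain ⟨y, hy, rfl⟩ := hx'
            refine ⟨y, ?_, rfl⟩
            rw [mem_closedBall_zero_iff] at hy
            rw [mem_ball_zero_iff] at hx ⊢
            refine lt_of_le_of_ne hy fun h => ?_
            have : f y = y := by rw [hfeq, h2 y h]; module
            rw [this] at hx
            exact hx.ne h
          · right; exact hx'
        · exact ⟨f 0, hmaps 0 (mem_ball_self hR), ⟨0, mem_ball_self hR, rfl⟩⟩
    have := integral_image_eq_integral_abs_det_fderiv_smul (volume : Measure E)
      (measurableSet_ball (x := (0:E)) (ε := R)) (fun x _ => (hder x).hasFDerivWithinAt) hinj (fun _ => (1:ℝ))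
    rw [himg] at this
    simp only [integral_const, smul_eq_mul, mul_one, measureReal_restrict_apply_univ] at this
    rw [this]
    refine setIntegral_congr_fun measurableSet_ball fun x hx => ?_
    exact (abs_of_pos (hdetpos t ht0 ht x (ball_subset_closedBall hx))).symm
  obtain ⟨k, t, c, ht, hc, hdet⟩ := det_interp E ε hεpos
  have hzero : ∫ x in ball (0:E) R, (ContinuousLinearMap.id ℝ E + fderiv ℝ u x).det = 0 := by
    rw [setIntegral_congr_fun (g := fun _ => (0:ℝ)) measurableSet_ball, integral_zero]
    intro x hx
    have hrd : Differentiable ℝ r := hr.differentiable (by norm_num)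
    have hfr : ContinuousLinearMap.id ℝ E + fderiv ℝ u x = fderiv ℝ r x := by
      have : HasFDerivAt u (fderiv ℝ r x - ContinuousLinearMap.id ℝ E) x :=
        (hrd x).hasFDerivAt.sub (hasFDerivAt_id x)
      rw [this.fderiv]; abel
    have hperp : ∀ w, inner ℝ (r x) (fderiv ℝ r x w) = 0 := by
      intro w
      have hA : HasFDerivAt (fun y => ‖r y‖ ^ 2) _ x := (hrd x).hasFDerivAt.norm_sq
      have hB : HasFDerivAt (fun y => ‖r y‖ ^ 2) (0 : E →L[ℝ] ℝ) x := by
        refine (hasFDerivAt_const (R^2) x).congr_of_eventuallyEq ?_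
        filter_upwards [isOpen_ball.mem_nhds hx] with y hy
        rw [h1 y (mem_ball_zero_iff.mp hy).le]
      have := congrArg (fun T : E →L[ℝ] ℝ => T w) (hA.unique hB)
      simpa using this
    show (ContinuousLinearMap.id ℝ E + fderiv ℝ u x).det = 0
    rw [hfr]
    by_contra hne
    have hsurj : Function.Surjective (fderiv ℝ r x) := by
      have hu : IsUnit (LinearMap.det (fderiv ℝ r x).toLinearMap) := isUnit_iff_ne_zero.mpr hne
      have := (LinearMap.isUnit_iff_isUnit_det (fderiv ℝ r x).toLinearMap).mpr hu
      exact ((Module.End.isUnit_iff _).mp this).2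
    obtain ⟨w, hw⟩ := hsurj (r x)
    have := hperp w
    rw [hw, real_inner_self_eq_norm_sq, h1 x (mem_ball_zero_iff.mp hx).le] at this
    exact (pow_pos hR 2).ne' this
  have hfin : ∫ x in ball (0:E) R, (ContinuousLinearMap.id ℝ E + fderiv ℝ u x).det
      = volume.real (ball (0:E) R) := by
    rw [show (fun x => (ContinuousLinearMap.id ℝ E + fderiv ℝ u x).det) =
      fun x => ∑ i, c i * (ContinuousLinearMap.id ℝ E + t i • fderiv ℝ u x).det from
        funext fun x => hdet _]
    rw [integral_finsetSum _ (fun i _ => (hIntg (t i)).const_mul (c i))]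
    simp_rw [integral_const_mul]
    rw [Finset.sum_congr rfl (fun i _ => by rw [hvol (t i) (ht i).1 (ht i).2]), ← Finset.sum_mul, hc,
      one_mul]
  rw [hzero] at hfin
  have : 0 < volume.real (ball (0:E) R) :=
    ENNReal.toReal_pos (measure_ball_pos volume _ hR).ne' measure_ball_lt_top.ne
  linarith

lemma no_nonvanishing_euclid (m : ℕ) (G : EuclideanSpace ℝ (Fin m) → EuclideanSpace ℝ (Fin m))
    (hG : Continuous G) (R : ℝ) (hid : ∀ y, R ≤ ‖y‖ → G y = y) (h0 : ∀ y, G y ≠ 0) : False := by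
  wlog hR : 0 < R generalizing R
  · exact this 1 (fun y hy => hid y (by linarith)) one_pos
  set δ : EuclideanSpace ℝ (Fin m) → ℝ := fun y => ‖G y‖ with hδ
  obtain ⟨g, hg, hsupp⟩ := Continuous.exists_contMDiff_approx (f := fun y => G y - y) (ε := δ)
    (I := 𝓘(ℝ, EuclideanSpace ℝ (Fin m))) 1 (by fun_prop) (by fun_prop)
    (fun x => norm_pos_iff.mpr (h0 x))
  have hgd : ContDiff ℝ 1 g := g.contMDiff.contDiff
  have hgid : ∀ y, R ≤ ‖y‖ → g y = 0 := by
    intro y hy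
    by_contra hne
    have := hsupp (Function.mem_support.mpr hne)
    simp [hid y hy] at this
  have hne : ∀ y, y + g y ≠ 0 := by
    intro y hy
    have h := hg y
    rw [dist_eq_norm] at h
    have : g y - (G y - y) = - G y := by
      rw [eq_neg_of_add_eq_zero_right hy]; abel
    rw [this, norm_neg] at h
    exact lt_irrefl _ h
  refine no_smooth_retraction (fun y => (R * ‖y + g y‖⁻¹) • (y + g y)) ?_ R hR ?_ ?_
  · have hs : ContDiff ℝ 1 fun y => y + g y := contDiff_id.add hgd
    exact (contDiff_const.mul ((hs.norm ℝ hne).inv (fun y => norm_ne_zero_iff.mpr (hne y)))).smul hs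
  · intro y _
    have := norm_pos_iff.mpr (hne y)
    rw [norm_smul, Real.norm_of_nonneg (by positivity)]
    field_simp
  · intro y hy
    have : g y = 0 := hgid y hy.ge
    simp only [this, add_zero, hy]
    rw [mul_inv_cancel₀ hR.ne', one_smul]

lemma no_nonvanishing {E : Type*} [NormedAddCommGroup E] [NormedSpace ℝ E] [FiniteDimensional ℝ E]
    (G : E → E)
    (hG : Continuous G) (R : ℝ) (hid : ∀ y, R ≤ ‖y‖ → G y = y) (h0 : ∀ y, G y ≠ 0) : False := by
  let e : E ≃L[ℝ] EuclideanSpace ℝ (Fin (Module.finrank ℝ E)) := toEuclidean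
  refine no_nonvanishing_euclid _ (fun y => e (G (e.symm y))) (by fun_prop)
    ((‖e.toContinuousLinearMap‖ + 1) * R) ?_ ?_
  · intro y hy
    rw [hid, e.apply_symm_apply]
    by_contra hlt
    push Not at hlt
    have h1 : ‖y‖ ≤ ‖e.toContinuousLinearMap‖ * ‖e.symm y‖ := by
      have := e.toContinuousLinearMap.le_opNorm (e.symm y)
      simpa using this
    have h2 : 0 ≤ ‖e.toContinuousLinearMap‖ := norm_nonneg _
    have h3 : 0 ≤ ‖e.symm y‖ := norm_nonneg _
    nlinarith
  · intro y hy
    exact h0 _ (e.map_eq_zero_iff.mp hy)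

lemma no_proper_family {E V : Type*} [NormedAddCommGroup E] [NormedSpace ℝ E]
    [FiniteDimensional ℝ E] [NormedAddCommGroup V] [NormedSpace ℝ V] [FiniteDimensional ℝ V]
    (hdim : Module.finrank ℝ E < Module.finrank ℝ V)
    (F : E → V → E) (hF : Continuous fun p : E × V => F p.1 p.2) (hF0 : ∀ y, F y 0 = y)
    (M : ℝ) (hM : ∀ y v v', F y v = 0 → F y v' = 0 → ‖v' - v‖ ≤ M)
    (hR : ∀ ρ : ℝ, ∃ R : ℝ, ∀ y v, F y v = 0 → ‖v‖ ≤ ρ → ‖y‖ ≤ R)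
    (hB : ∀ ρ : ℝ, ∃ R : ℝ, ∀ y v, ‖y‖ ≤ ρ → F y v = 0 → ‖v‖ ≤ R) : False := by
  set N : ℝ := |M| + 1 with hN
  have hNpos : 0 < N := by positivity
  have hMN : M < N := by have := le_abs_self M; linarith
  let t : E → Set V := fun y => {w | ∀ v, F y v = 0 → w ∈ ball v N}
  have ht : ∀ y, Convex ℝ (t y) := by
    intro y
    have : t y = ⋂ (v) (_ : F y v = 0), ball v N := by
      ext w; simp [t]
    rw [this]
    exact convex_iInter fun v => convex_iInter fun _ => convex_ball v N
  have hloc : ∀ y0 : E, ∃ c : V, ∀ᶠ y in 𝓝 y0, c ∈ t y := by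
    intro y0
    obtain ⟨c, hc⟩ : ∃ c : V, ∀ v, F y0 v = 0 → c ∈ ball v N := by
      by_cases h : ∃ v, F y0 v = 0
      · obtain ⟨c, hc⟩ := h
        refine ⟨c, fun v hv => ?_⟩
        rw [mem_ball, dist_eq_norm]
        exact (hM y0 v c hv hc).trans_lt hMN
      · exact ⟨0, fun v hv => absurd ⟨v, hv⟩ h⟩
    refine ⟨c, ?_⟩
    obtain ⟨R, hR'⟩ := hB (‖y0‖ + 1)
    let S : Set (E × V) := (closedBall y0 1 ×ˢ closedBall 0 R) ∩
      {p | F p.1 p.2 = 0 ∧ N ≤ dist c p.2}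
    have hS : IsCompact S := by
      refine ((isCompact_closedBall y0 1).prod (isCompact_closedBall 0 R)).inter_right ?_
      exact (isClosed_eq hF continuous_const).inter
        (isClosed_le continuous_const (continuous_const.dist continuous_snd))
    have hcl : IsClosed (Prod.fst '' S) := (hS.image continuous_fst).isClosed
    have hy0 : y0 ∉ Prod.fst '' S := by
      rintro ⟨⟨y, v⟩, hp, rfl⟩
      have := hc v hp.2.1
      rw [mem_ball] at this
      exact absurd hp.2.2 (not_le.mpr this)
    filter_upwards [hcl.isOpen_compl.mem_nhds hy0, ball_mem_nhds y0 one_pos] with y hy1 hy2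
    intro v hv
    by_contra hcon
    rw [mem_ball, not_lt] at hcon
    apply hy1
    refine ⟨(y, v), ⟨⟨ball_subset_closedBall hy2, ?_⟩, hv, hcon⟩, rfl⟩
    rw [mem_closedBall_zero_iff]
    refine hR' y v ?_ hv
    have : ‖y - y0‖ < 1 := by rwa [mem_ball, dist_eq_norm] at hy2
    have h3 := norm_sub_norm_le y y0
    linarith
  obtain ⟨w, hw⟩ := exists_contMDiffMap_forall_mem_convex_of_local_const (n := 1)
    𝓘(ℝ, E) ht hloc
  have hwd : ContDiff ℝ 1 w := w.contMDiff.contDiff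
  have hdense := hwd.dense_compl_range_of_finrank_lt_finrank hdim
  obtain ⟨c, hc1, hc2⟩ := hdense.exists_mem_open isOpen_ball (nonempty_ball.mpr hNpos : (ball (0:V) N).Nonempty)
  rw [mem_ball_zero_iff] at hc2
  have hne : ∀ y, w y - c ≠ 0 := by
    intro y h
    exact hc1 ⟨y, sub_eq_zero.mp h⟩
  have hnp : ∀ y, 0 < ‖w y - c‖ := fun y => norm_pos_iff.mpr (hne y)
  obtain ⟨R, hR'⟩ := hR (2 * N)
  -- cutoff
  let χ : E → ℝ := fun y => max 0 (min 1 (R + 2 - ‖y‖))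
  have hχ0 : ∀ y, 0 ≤ χ y := fun y => le_max_left _ _
  have hχ1 : ∀ y, χ y ≤ 1 := fun y => max_le zero_le_one (min_le_left _ _)
  have hwc : Continuous w := hwd.continuous
  let l : E → V := fun y => (-(χ y * (2 * N) * ‖w y - c‖⁻¹)) • (w y - c)
  have hl : Continuous l := by
    refine Continuous.smul ?_ (by fun_prop)
    refine Continuous.neg (Continuous.mul (by fun_prop) ?_)
    exact Continuous.inv₀ (by fun_prop) (fun y => (hnp y).ne')
  have hln : ∀ y, ‖l y‖ ≤ 2 * N := by
    intro y
    have h1 := hχ0 y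
    have h2 := hnp y
    have h3 := hχ1 y
    simp only [l]
    rw [norm_smul, norm_neg, Real.norm_of_nonneg (by positivity), mul_assoc, inv_mul_cancel₀ h2.ne',
      mul_one]
    nlinarith
  refine no_nonvanishing (fun y => F y (l y)) (hF.comp (continuous_id.prodMk hl)) (R + 2) ?_ ?_
  · intro y hy
    have : χ y = 0 := by
      simp only [χ]
      exact max_eq_left ((min_le_right _ _).trans (by linarith))
    have : l y = 0 := by simp [l, this]
    simp only [this, hF0]
  · intro y hy
    have hyR : ‖y‖ ≤ R := hR' y (l y) hy (hln y)
    have hχ : χ y = 1 := by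
      simp only [χ]
      rw [min_eq_left (by linarith), max_eq_right zero_le_one]
    have h1 : w y ∈ ball (l y) N := hw y (l y) hy
    rw [mem_ball, dist_eq_norm] at h1
    have h2 : w y - c - l y = (1 + 2 * N * ‖w y - c‖⁻¹) • (w y - c) := by
      simp only [l, hχ]; module
    have h3 : ‖w y - c - l y‖ = ‖w y - c‖ + 2 * N := by
      have := hnp y
      rw [h2, norm_smul, Real.norm_of_nonneg (by positivity), add_mul, mul_assoc,
        inv_mul_cancel₀ this.ne']
      ring
    have h4 : ‖w y - c - l y‖ ≤ ‖w y - l y‖ + ‖c‖ := by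
      rw [show w y - c - l y = (w y - l y) - c by abel]
      exact norm_sub_le _ _
    have := hnp y
    linarith

end TopPart

section GroupPart

open Matrix

variable {𝕜 : Type*} [RCLike 𝕜] {n : ℕ}

lemma slc_mul (g h : SpecialLinearGroup (Fin n) 𝕜) :
    ((g * h : SpecialLinearGroup (Fin n) 𝕜) : Matrix (Fin n) (Fin n) 𝕜)
      = (g : Matrix (Fin n) (Fin n) 𝕜) * (h : Matrix (Fin n) (Fin n) 𝕜) :=
  Matrix.SpecialLinearGroup.coe_mul g h

lemma slc_one : ((1 : SpecialLinearGroup (Fin n) 𝕜) : Matrix (Fin n) (Fin n) 𝕜) = 1 :=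
  Matrix.SpecialLinearGroup.coe_one

lemma slc_inv_mul (g : SpecialLinearGroup (Fin n) 𝕜) :
    ((g⁻¹ : SpecialLinearGroup (Fin n) 𝕜) : Matrix (Fin n) (Fin n) 𝕜)
      * (g : Matrix (Fin n) (Fin n) 𝕜) = 1 := by
  rw [← slc_mul, inv_mul_cancel, slc_one]

lemma slc_ext {g h : SpecialLinearGroup (Fin n) 𝕜}
    (hgh : (g : Matrix (Fin n) (Fin n) 𝕜) = (h : Matrix (Fin n) (Fin n) 𝕜)) : g = h :=
  Subtype.ext hgh

lemma sl_isClosedEmbedding :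
    Topology.IsClosedEmbedding (fun g : SpecialLinearGroup (Fin n) 𝕜 => (g : Matrix (Fin n) (Fin n) 𝕜)) :=
  Matrix.SpecialLinearGroup.isClosedEmbedding_val (n := Fin n) (R := 𝕜)

instance sl_topGroup : IsTopologicalGroup (SpecialLinearGroup (Fin n) 𝕜) :=
  Matrix.SpecialLinearGroup.topologicalGroup (n := Fin n) (R := 𝕜)

lemma sl_continuous_coe :
    Continuous (fun g : SpecialLinearGroup (Fin n) 𝕜 => (g : Matrix (Fin n) (Fin n) 𝕜)) :=
  sl_isClosedEmbedding.continuous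

lemma sl_continuous_entry (i j : Fin n) :
    Continuous (fun g : SpecialLinearGroup (Fin n) 𝕜 => (g : Matrix (Fin n) (Fin n) 𝕜) i j) :=
  sl_continuous_coe.matrix_elem i j

instance sl_locallyCompact : LocallyCompactSpace (SpecialLinearGroup (Fin n) 𝕜) := by
  have : LocallyCompactSpace (Matrix (Fin n) (Fin n) 𝕜) :=
    inferInstanceAs (LocallyCompactSpace (Fin n → Fin n → 𝕜))
  exact sl_isClosedEmbedding.locallyCompactSpace

/-- Elements of `SL_n` all of whose entries are bounded by `M`. -/
def bddSL (n : ℕ) (𝕜 : Type*) [RCLike 𝕜] (M : ℝ) : Set (SpecialLinearGroup (Fin n) 𝕜) :=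
  {g | ∀ i j, ‖(g : Matrix (Fin n) (Fin n) 𝕜) i j‖ ≤ M}

lemma isCompact_bddSL (M : ℝ) : IsCompact (bddSL n 𝕜 M) := by
  have h : IsCompact (Set.pi Set.univ fun _ : Fin n => Set.pi Set.univ fun _ : Fin n =>
      Metric.closedBall (0:𝕜) M) :=
    isCompact_univ_pi fun _ => isCompact_univ_pi fun _ => isCompact_closedBall _ _
  have h2 := (sl_isClosedEmbedding (𝕜 := 𝕜) (n := n)).isCompact_preimage h
  have h3 : bddSL n 𝕜 M = (fun g : SpecialLinearGroup (Fin n) 𝕜 =>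
      (g : Matrix (Fin n) (Fin n) 𝕜)) ⁻¹' (Set.pi Set.univ fun _ : Fin n =>
        Set.pi Set.univ fun _ : Fin n => Metric.closedBall (0:𝕜) M) := by
    ext g
    constructor
    · intro hg i _ j _
      exact mem_closedBall_zero_iff.mpr (hg i j)
    · intro hg i j
      exact mem_closedBall_zero_iff.mp (hg i trivial j trivial)
  rw [h3]
  exact h2

lemma exists_entry_bound {D : Set (SpecialLinearGroup (Fin n) 𝕜)} (hD : IsCompact D) :
    ∃ M : ℝ, ∀ g ∈ D, ∀ i j, ‖(g : Matrix (Fin n) (Fin n) 𝕜) i j‖ ≤ M := by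
  have h : ∀ i j : Fin n, ∃ M : ℝ, ∀ g ∈ D, ‖(g : Matrix (Fin n) (Fin n) 𝕜) i j‖ ≤ M := fun i j =>
    hD.exists_bound_of_continuousOn (sl_continuous_entry i j).continuousOn
  choose M hM using h
  refine ⟨∑ i, ∑ j, |M i j|, fun g hg i j => (hM i j g hg).trans ?_⟩
  refine (le_abs_self _).trans ?_
  refine (Finset.single_le_sum (f := fun j => |M i j|) (fun _ _ => abs_nonneg _)
    (Finset.mem_univ j)).trans ?_
  exact Finset.single_le_sum (f := fun i => ∑ j, |M i j|)
    (fun _ _ => Finset.sum_nonneg fun _ _ => abs_nonneg _) (Finset.mem_univ i)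

instance quotient_t2 : T2Space (SpecialLinearGroup (Fin n) 𝕜 ⧸ sl2Block n 𝕜) := by
  let f : SpecialLinearGroup (Fin n) 𝕜 → (Fin n → Fin n → 𝕜) × (Fin n → Fin n → 𝕜) := fun g =>
    (fun i j => if 2 ≤ (j : ℕ) then (g : Matrix (Fin n) (Fin n) 𝕜) i j else 0,
     fun i j => if 2 ≤ (i : ℕ) then ((g⁻¹ : SpecialLinearGroup (Fin n) 𝕜) : Matrix (Fin n) (Fin n) 𝕜) i j else 0)
  have hf : Continuous f := by
    refine Continuous.prodMk ?_ ?_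
    · refine continuous_pi fun i => continuous_pi fun j => ?_
      split_ifs
      · exact sl_continuous_entry i j
      · exact continuous_const
    · refine continuous_pi fun i => continuous_pi fun j => ?_
      split_ifs
      · exact (sl_continuous_entry i j).comp continuous_inv
      · exact continuous_const
  have hinv : ∀ g h : SpecialLinearGroup (Fin n) 𝕜, h ∈ sl2Block n 𝕜 → f (g * h) = f g := by
    intro g h hh
    have h1 : Pblock (h : Matrix (Fin n) (Fin n) 𝕜) := hh
    have h2 : Pblock ((h⁻¹ : SpecialLinearGroup (Fin n) 𝕜) : Matrix (Fin n) (Fin n) 𝕜) :=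
      (sl2Block n 𝕜).inv_mem hh
    refine Prod.ext ?_ ?_
    · funext i j
      simp only [f]
      split_ifs with hj
      · rw [slc_mul, Matrix.mul_apply]
        simp [h1 _ j (Or.inr hj)]
      · rfl
    · funext i j
      simp only [f]
      split_ifs with hi
      · rw [_root_.mul_inv_rev, slc_mul, Matrix.mul_apply]
        simp [h2 i _ (Or.inl hi)]
      · rfl
  let F : SpecialLinearGroup (Fin n) 𝕜 ⧸ sl2Block n 𝕜 → (Fin n → Fin n → 𝕜) × (Fin n → Fin n → 𝕜) :=
    Quotient.lift f (by
      intro a b hab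
      have : a⁻¹ * b ∈ sl2Block n 𝕜 := QuotientGroup.leftRel_apply.mp hab
      have h := hinv a _ this
      rw [mul_inv_cancel_left] at h
      exact h.symm)
  have hF : Continuous F := hf.quotient_lift _
  refine T2Space.of_injective_continuous (f := F) ?_ hF
  intro x y
  induction x using QuotientGroup.induction_on with | _ a => ?_
  induction y using QuotientGroup.induction_on with | _ b => ?_
  intro hab
  have hab' : f a = f b := hab
  rw [QuotientGroup.eq]
  have ha1 : ((a⁻¹ : SpecialLinearGroup (Fin n) 𝕜) : Matrix (Fin n) (Fin n) 𝕜) * a = 1 := slc_inv_mul _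
  have hb1 : ((b⁻¹ : SpecialLinearGroup (Fin n) 𝕜) : Matrix (Fin n) (Fin n) 𝕜) * b = 1 := slc_inv_mul _
  show Pblock _
  intro i j hij
  rw [slc_mul]
  rcases hij with hi | hj
  · have h1 : ∀ k, ((a⁻¹ : SpecialLinearGroup (Fin n) 𝕜) : Matrix (Fin n) (Fin n) 𝕜) i k
      = ((b⁻¹ : SpecialLinearGroup (Fin n) 𝕜) : Matrix (Fin n) (Fin n) 𝕜) i k := by
      intro k
      have := congrFun (congrFun (congrArg Prod.snd hab') i) k
      simpa only [f, if_pos hi] using this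
    rw [Matrix.mul_apply]
    simp_rw [h1]
    rw [← Matrix.mul_apply, hb1, Matrix.one_apply]
  · have h1 : ∀ k, (b : Matrix (Fin n) (Fin n) 𝕜) k j = (a : Matrix (Fin n) (Fin n) 𝕜) k j := by
      intro k
      have := congrFun (congrFun (congrArg Prod.fst hab') k) j
      simpa only [f, if_pos hj] using this.symm
    rw [Matrix.mul_apply]
    simp_rw [h1]
    rw [← Matrix.mul_apply, ha1, Matrix.one_apply]

/-- compact subsets of the quotient lift. -/
lemma exists_compact_lift {C : Set (SpecialLinearGroup (Fin n) 𝕜 ⧸ sl2Block n 𝕜)}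
    (hC : IsCompact C) : ∃ D : Set (SpecialLinearGroup (Fin n) 𝕜), IsCompact D ∧
      ∀ x ∈ C, ∃ d ∈ D, (QuotientGroup.mk d : SpecialLinearGroup (Fin n) 𝕜 ⧸ sl2Block n 𝕜) = x := by
  obtain ⟨t, ht⟩ := hC.elim_finite_subcover
    (fun M : ℕ => (QuotientGroup.mk : _ → SpecialLinearGroup (Fin n) 𝕜 ⧸ sl2Block n 𝕜) ''
      {g | ∀ i j, ‖(g : Matrix (Fin n) (Fin n) 𝕜) i j‖ < M})
    (by
      intro M
      refine QuotientGroup.isOpenMap_coe _ ?_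
      simp only [Set.ofPred_forall]
      exact isOpen_iInter_of_finite fun i => isOpen_iInter_of_finite fun j =>
        isOpen_lt (sl_continuous_entry i j).norm continuous_const)
    (by
      intro x _
      induction x using QuotientGroup.induction_on with | _ a => ?_
      obtain ⟨M, hM⟩ := exists_entry_bound (isCompact_singleton (x := a))
      obtain ⟨N, hN⟩ := exists_nat_gt M
      exact Set.mem_iUnion.mpr ⟨N, a, fun i j => (hM a rfl i j).trans_lt hN, rfl⟩)
  refine ⟨⋃ M ∈ t, bddSL n 𝕜 M, t.isCompact_biUnion fun M _ => isCompact_bddSL _, ?_⟩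
  intro x hx
  obtain ⟨M, hM, a, ha, rfl⟩ := Set.mem_iUnion₂.mp (ht hx)
  exact ⟨a, Set.mem_iUnion₂.mpr ⟨M, hM, fun i j => (ha i j).le⟩, rfl⟩

/-! ### Transvections -/

/-- The matrix `1 + w e_jᵀ`. -/
def tvM (j : Fin n) (w : Fin n → 𝕜) : Matrix (Fin n) (Fin n) 𝕜 := 1 + vecMulVec w (Pi.single j 1)

lemma tvM_apply (j : Fin n) (w : Fin n → 𝕜) (a b : Fin n) :
    tvM j w a b = (if a = b then 1 else 0) + if b = j then w a else 0 := by
  simp [tvM, vecMulVec_apply, Matrix.one_apply, Pi.single_apply]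

/-- The transvection `1 + w e_jᵀ`, where `w_j = 0`. -/
def tv (j : Fin n) (w : Fin n → 𝕜) (hw : w j = 0) : SpecialLinearGroup (Fin n) 𝕜 :=
  ⟨tvM j w, by
    rw [tvM, vecMulVec_eq Unit, det_one_add_replicateCol_mul_replicateRow]
    simp [hw]⟩

lemma tv_coe (j : Fin n) (w : Fin n → 𝕜) (hw : w j = 0) :
    ((tv j w hw : SpecialLinearGroup (Fin n) 𝕜) : Matrix (Fin n) (Fin n) 𝕜) = tvM j w := rfl

lemma tv_mul (j : Fin n) (w w' : Fin n → 𝕜) (hw : w j = 0) (hw' : w' j = 0) :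
    tv j w hw * tv j w' hw' = tv j (w + w') (by simp [hw, hw']) := by
  apply slc_ext
  rw [slc_mul, tv_coe, tv_coe, tv_coe]
  simp only [tvM, mul_add, add_mul, one_mul, mul_one, vecMulVec_mul_vecMulVec, add_vecMulVec]
  simp [hw', add_assoc]

lemma tv_conj (i j : Fin n) (w v : Fin n → 𝕜) (hwj : w j = 0) (hwi : w i = 0)
    (hv : v i = 0) :
    tv j w hwj * tv i v hv * tv j (-w) (by simp [hwj]) = tv i (v + v j • w) (by simp [hv, hwi]) := by
  apply slc_ext
  rw [slc_mul, slc_mul, tv_coe, tv_coe, tv_coe, tv_coe]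
  simp only [tvM, mul_add, add_mul, one_mul, mul_one, vecMulVec_mul_vecMulVec, add_vecMulVec]
  simp [hv, hwi, hwj, neg_vecMulVec, smul_vecMulVec]
  abel

lemma tv_inv (j : Fin n) (w : Fin n → 𝕜) (hw : w j = 0) :
    (tv j w hw)⁻¹ = tv j (-w) (by simp [hw]) := by
  rw [inv_eq_iff_mul_eq_one, tv_mul]
  apply slc_ext
  rw [tv_coe, slc_one]
  simp [tvM]

lemma tv_mem_bdd (j : Fin n) (w : Fin n → 𝕜) (hw : w j = 0) (M : ℝ) (hM : ∀ k, ‖w k‖ ≤ M) :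
    tv j w hw ∈ bddSL n 𝕜 (1 + M) := by
  intro a b
  have h0 : 0 ≤ M := (norm_nonneg _).trans (hM j)
  rw [tv_coe, tvM_apply]
  refine (norm_add_le _ _).trans (add_le_add ?_ ?_)
  · split_ifs <;> simp
  · split_ifs
    · exact hM a
    · simpa using h0

lemma continuous_tv {X : Type*} [TopologicalSpace X] (j : Fin n) (w : X → Fin n → 𝕜)
    (hw : ∀ x, w x j = 0) (hc : Continuous w) : Continuous fun x => tv j (w x) (hw x) := by
  rw [sl_isClosedEmbedding.isEmbedding.continuous_iff]
  refine continuous_matrix fun a b => ?_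
  simp only [Function.comp_def, tv_coe, tvM_apply]
  split_ifs <;> fun_prop

end GroupPart


section GroupPart2

open Matrix Pointwise

variable {𝕜 : Type*} [RCLike 𝕜] {m : ℕ}

/-- The index `0`. -/
def i0 : Fin (m + 4) := ⟨0, by omega⟩
/-- The index `1`. -/
def i1 : Fin (m + 4) := ⟨1, by omega⟩
/-- The index `2`. -/
def i2 : Fin (m + 4) := ⟨2, by omega⟩
/-- The index `3`. -/
def i3 : Fin (m + 4) := ⟨3, by omega⟩

lemma i01 : (i0 : Fin (m + 4)) ≠ i1 := by simp [i0, i1]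
lemma i10 : (i1 : Fin (m + 4)) ≠ i0 := by simp [i0, i1]

lemma tv_congr {n : ℕ} {i : Fin n} {v w : Fin n → 𝕜} {hv : v i = 0} {hw : w i = 0} (h : v = w) :
    tv i v hv = tv i w hw := by
  subst h; rfl

lemma one_mem_bdd : (1 : SpecialLinearGroup (Fin (m + 4)) 𝕜) ∈ bddSL (m + 4) 𝕜 4 := by
  intro a b
  rw [slc_one, Matrix.one_apply]
  split_ifs <;> simp

lemma khk (u : Fin (m + 4) → 𝕜) (hu : u i1 = 0) :
    ∃ k ∈ bddSL (m + 4) 𝕜 4 * bddSL (m + 4) 𝕜 4, ∃ h ∈ sl2Block (m + 4) 𝕜,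
      ∃ k' ∈ bddSL (m + 4) 𝕜 4 * bddSL (m + 4) 𝕜 4, tv i1 u hu = k * h * k' := by
  obtain ⟨i, hi⟩ := Finite.exists_max (fun k => ‖u k‖)
  by_cases hc : u i = 0
  · have hu0 : u = 0 := by
      funext k
      have := hi k
      rw [hc, norm_zero] at this
      simpa using this
    refine ⟨1, ⟨1, one_mem_bdd, 1, one_mem_bdd, by simp⟩, 1, one_mem _,
      1, ⟨1, one_mem_bdd, 1, one_mem_bdd, by simp⟩, ?_⟩
    apply slc_ext
    subst hu0
    simp only [mul_one]
    rw [tv_coe, slc_one]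
    simp [tvM]
  have hi1 : i ≠ i1 := by
    rintro rfl; exact hc hu
  set c := u i with hcdef
  have hcn : 0 < ‖c‖ := norm_pos_iff.mpr hc
  have hbd : ∀ k, ‖c⁻¹ * u k‖ ≤ 1 := by
    intro k
    rw [norm_mul, norm_inv, inv_mul_le_iff₀ hcn, mul_one]
    exact hi k
  have hH : tv i1 (Pi.single i0 c) (by simp [i10]) ∈ sl2Block (m + 4) 𝕜 := by
    intro a b hab
    change tvM _ _ a b = _
    rw [tvM_apply]
    have : (if b = i1 then (Pi.single i0 c : Fin (m + 4) → 𝕜) a else 0) = 0 := by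
      split_ifs with hb
      · have : a ≠ i0 := by
          subst hb
          rintro rfl
          simp [i0, i1] at hab
        simp [this]
      · rfl
    rw [this, add_zero]
  by_cases hi0 : i = i0
  · subst hi0
    set w : Fin (m + 4) → 𝕜 := c⁻¹ • u - Pi.single i0 1 with hw
    have hw0 : w i0 = 0 := by simp [hw, ← hcdef, hc]
    have hw1 : w i1 = 0 := by simp [hw, hu, i10]
    have hwb : ∀ k, ‖w k‖ ≤ 3 := by
      intro k
      have h1 : ‖(Pi.single i0 1 : Fin (m + 4) → 𝕜) k‖ ≤ 1 := by
        rw [Pi.single_apply]; split_ifs <;> simp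
      have := norm_sub_le (c⁻¹ * u k) ((Pi.single i0 1 : Fin (m + 4) → 𝕜) k)
      have h3 := hbd k
      simp only [hw, Pi.sub_apply, Pi.smul_apply, smul_eq_mul]
      linarith
    have h4 : (1 + 3 : ℝ) = 4 := by norm_num
    have m1 := tv_mem_bdd i0 w hw0 3 hwb
    have m2 := tv_mem_bdd i0 (-w) (by simp [hw0]) 3 (by simpa using hwb)
    rw [h4] at m1 m2
    refine ⟨_, ⟨_, m1, 1, one_mem_bdd, rfl⟩, _, hH, _, ⟨_, m2, 1, one_mem_bdd, rfl⟩, ?_⟩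
    simp only [mul_one]
    rw [tv_conj _ _ _ _ _ hw1]
    apply tv_congr
    funext k
    simp only [hw, Pi.add_apply, Pi.smul_apply, Pi.sub_apply, smul_eq_mul, Pi.single_eq_same]
    rw [Pi.single_apply, Pi.single_apply]
    split_ifs <;> field_simp <;> ring
  · set w : Fin (m + 4) → 𝕜 := c⁻¹ • u - Pi.single i0 1 - Pi.single i 1 with hw
    have hwi : w i = 0 := by simp [hw, ← hcdef, hc, hi0]
    have hw1 : w i1 = 0 := by simp [hw, hu, i10, hi1.symm]
    have hsb : ∀ j k, ‖(Pi.single j 1 : Fin (m + 4) → 𝕜) k‖ ≤ 1 := by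
      intro j k
      rw [Pi.single_apply]; split_ifs <;> simp
    have hsb3 : ∀ j k, ‖(Pi.single j 1 : Fin (m + 4) → 𝕜) k‖ ≤ 3 := 
      fun j k => (hsb j k).trans (by norm_num)
    have hwb : ∀ k, ‖w k‖ ≤ 3 := by
      intro k
      have := norm_sub_le (c⁻¹ * u k) ((Pi.single i0 1 : Fin (m + 4) → 𝕜) k)
      have h2 := norm_sub_le (c⁻¹ * u k - (Pi.single i0 1 : Fin (m + 4) → 𝕜) k)
        ((Pi.single i 1 : Fin (m + 4) → 𝕜) k)
      have h3 := hbd k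
      have h4 := hsb i0 k
      have h5 := hsb i k
      simp only [hw, Pi.sub_apply, Pi.smul_apply, smul_eq_mul]
      linarith
    have h4 : (1 + 3 : ℝ) = 4 := by norm_num
    have hs0 : (Pi.single i 1 : Fin (m + 4) → 𝕜) i0 = 0 := by simp [Ne.symm hi0]
    have hs1 : (Pi.single i 1 : Fin (m + 4) → 𝕜) i1 = 0 := by simp [Ne.symm hi1]
    have m1 := tv_mem_bdd i w hwi 3 hwb
    have m2 := tv_mem_bdd i (-w) (by simp [hwi]) 3 (by simpa using hwb)
    have m3 := tv_mem_bdd i0 (Pi.single i (1:𝕜)) hs0 3 (hsb3 i)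
    have m4 := tv_mem_bdd i0 (-Pi.single i (1:𝕜)) (by simp [hs0]) 3 (by simpa using hsb3 i)
    rw [h4] at m1 m2 m3 m4
    refine ⟨_, ⟨_, m1, _, m3, rfl⟩, _, hH, _, ⟨_, m4, _, m2, rfl⟩, ?_⟩
    have hassoc : ∀ a b c d e : SpecialLinearGroup (Fin (m + 4)) 𝕜,
      a * b * c * (d * e) = a * (b * c * d) * e := by intros; group
    simp only []
    rw [hassoc, tv_conj _ _ _ _ _ hs1, tv_conj _ _ _ _ _ hw1]
    apply tv_congr
    funext k
    simp only [hw, Pi.add_apply, Pi.smul_apply, Pi.sub_apply, smul_eq_mul, Pi.single_eq_same]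
    rw [Pi.single_eq_of_ne hi0]
    simp only [Pi.single_apply]
    split_ifs <;> field_simp <;> ring

/-- The inclusion of `𝕜³` into the column space. -/
def iota (v : Fin 3 → 𝕜) : Fin (m + 4) → 𝕜 := fun k =>
  if (k : ℕ) = 0 then v 0 else if (k : ℕ) = 2 then v 1 else if (k : ℕ) = 3 then v 2 else 0

lemma iota_one (v : Fin 3 → 𝕜) : (iota v : Fin (m + 4) → 𝕜) i1 = 0 := by simp [iota, i1]

lemma continuous_iota : Continuous (iota : (Fin 3 → 𝕜) → Fin (m + 4) → 𝕜) := by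
  refine continuous_pi fun k => ?_
  unfold iota
  split_ifs <;> fun_prop

lemma iota_add (v w : Fin 3 → 𝕜) : (iota (v + w) : Fin (m + 4) → 𝕜) = iota v + iota w := by
  funext k
  simp only [iota, Pi.add_apply]
  split_ifs <;> simp

/-- The unipotent family. -/
def ell (v : Fin 3 → 𝕜) : SpecialLinearGroup (Fin (m + 4)) 𝕜 := tv i1 (iota v) (iota_one v)

lemma continuous_ell : Continuous (ell : (Fin 3 → 𝕜) → SpecialLinearGroup (Fin (m + 4)) 𝕜) :=
  continuous_tv _ _ _ continuous_iota

lemma ell_add (v w : Fin 3 → 𝕜) :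
    (ell (v + w) : SpecialLinearGroup (Fin (m + 4)) 𝕜) = ell v * ell w := by
  unfold ell
  rw [tv_mul]
  exact tv_congr (iota_add v w)

lemma ell_zero : (ell 0 : SpecialLinearGroup (Fin (m + 4)) 𝕜) = 1 := by
  have h := ell_add (𝕜 := 𝕜) (m := m) 0 0
  rw [add_zero] at h
  exact (left_eq_mul.mp h)

lemma norm_le_of_ell_entries (v : Fin 3 → 𝕜) (M : ℝ)
    (h : ∀ i j, ‖(ell v : SpecialLinearGroup (Fin (m + 4)) 𝕜).1 i j‖ ≤ M) : ‖v‖ ≤ M := by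
  have hM : 0 ≤ M := (norm_nonneg _).trans (h i0 i0)
  rw [pi_norm_le_iff_of_nonneg hM]
  intro k
  have key : ∀ a : Fin (m + 4), a ≠ i1 →
      (ell v : SpecialLinearGroup (Fin (m + 4)) 𝕜).1 a i1 = iota v a := by
    intro a ha
    change tvM _ _ a i1 = _
    simp [tvM_apply, ha]
  fin_cases k
  · have := h i0 i1
    rw [key _ i01] at this
    simpa [iota, i0] using this
  · have := h i2 i1
    rw [key _ (by simp [i1, i2])] at this
    simpa [iota, i2] using this
  · have := h i3 i1
    rw [key _ (by simp [i1, i3])] at this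
    simpa [iota, i3] using this

/-- The proper discontinuity hypothesis. -/
def PDisc {n : ℕ} (Γ : Subgroup (SpecialLinearGroup (Fin n) 𝕜)) : Prop :=
  ∀ A B : Set (SpecialLinearGroup (Fin n) 𝕜 ⧸ sl2Block n 𝕜),
        IsCompact A → IsCompact B →
        {γ : Γ | ∃ x ∈ A, (γ : SpecialLinearGroup (Fin n) 𝕜) • x ∈ B}.Finite

lemma PDisc.finite {n : ℕ} {Γ : Subgroup (SpecialLinearGroup (Fin n) 𝕜)} (hΓ : PDisc Γ)
    {D1 D2 : Set (SpecialLinearGroup (Fin n) 𝕜)} (h1 : IsCompact D1) (h2 : IsCompact D2) :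
    {γ : Γ | ∃ d1 ∈ D1, ∃ d2 ∈ D2, ∃ h ∈ sl2Block n 𝕜,
      (γ : SpecialLinearGroup (Fin n) 𝕜) * d1 * h = d2}.Finite := by
  have hq : Continuous (QuotientGroup.mk :
    SpecialLinearGroup (Fin n) 𝕜 → SpecialLinearGroup (Fin n) 𝕜 ⧸ sl2Block n 𝕜) :=
    QuotientGroup.continuous_mk
  refine (hΓ _ _ (h1.image hq) (h2.image hq)).subset ?_
  rintro γ ⟨d1, hd1, d2, hd2, h, hh, he⟩
  refine ⟨_, ⟨d1, hd1, rfl⟩, d2, hd2, ?_⟩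
  change (QuotientGroup.mk d2 : SpecialLinearGroup (Fin n) 𝕜 ⧸ sl2Block n 𝕜) =
    QuotientGroup.mk ((γ : SpecialLinearGroup (Fin n) 𝕜) * d1)
  rw [← he]
  exact QuotientGroup.mk_mul_of_mem _ hh

lemma prop_lemma {Γ : Subgroup (SpecialLinearGroup (Fin (m + 4)) 𝕜)} (hΓ : PDisc Γ)
    {D1 D2 : Set (SpecialLinearGroup (Fin (m + 4)) 𝕜)} (h1 : IsCompact D1) (h2 : IsCompact D2) :
    ∃ M : ℝ, ∀ v : Fin 3 → 𝕜, ∀ γ : Γ, ∀ d1 ∈ D1, ∀ d2 ∈ D2,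
      d1 * ell v = (γ : SpecialLinearGroup (Fin (m + 4)) 𝕜) * d2 → ‖v‖ ≤ M := by
  have hK : IsCompact (bddSL (m + 4) 𝕜 4 * bddSL (m + 4) 𝕜 4) :=
    (isCompact_bddSL 4).mul (isCompact_bddSL 4)
  set K := bddSL (m + 4) 𝕜 4 * bddSL (m + 4) 𝕜 4 with hKdef
  have hfin := hΓ.finite (h2.mul hK.inv) (h1.mul hK)
  have hcomp : IsCompact (⋃ γ ∈ {γ : Γ | ∃ d1 ∈ D2 * K⁻¹, ∃ d2 ∈ D1 * K,
      ∃ h ∈ sl2Block (m + 4) 𝕜, (γ : SpecialLinearGroup (Fin (m + 4)) 𝕜) * d1 * h = d2},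
      (D1⁻¹ * {(γ : SpecialLinearGroup (Fin (m + 4)) 𝕜)} * D2)) :=
    hfin.isCompact_biUnion fun γ _ => (h1.inv.mul isCompact_singleton).mul h2
  obtain ⟨M, hM⟩ := exists_entry_bound hcomp
  refine ⟨M, fun v γ d1 hd1 d2 hd2 he => norm_le_of_ell_entries (m := m) v M (hM _ ?_)⟩
  refine Set.mem_iUnion₂.mpr ⟨γ, ?_, ?_⟩
  · obtain ⟨k, hk, h, hh, k', hk', hv⟩ := khk (iota v : Fin (m + 4) → 𝕜) (iota_one v)
    change ell v = _ at hv
    refine ⟨d2 * k'⁻¹, Set.mul_mem_mul hd2 (Set.inv_mem_inv.mpr hk'), d1 * k,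
      Set.mul_mem_mul hd1 hk, h⁻¹, inv_mem hh, ?_⟩
    rw [← mul_assoc, ← he, hv]
    group
  · have : ell v = d1⁻¹ * (γ : SpecialLinearGroup (Fin (m + 4)) 𝕜) * d2 := by
      rw [mul_assoc, ← he]; group
    rw [this]
    exact Set.mul_mem_mul (Set.mul_mem_mul (Set.inv_mem_inv.mpr hd1) rfl) hd2

end GroupPart2


section GroupPart3

open Matrix Pointwise ComplexOrder

variable {𝕜 : Type*} [RCLike 𝕜] {n : ℕ}

lemma exists_P {Γ : Subgroup (SpecialLinearGroup (Fin n) 𝕜)} (hΓ : PDisc Γ)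
    {C : Set (SpecialLinearGroup (Fin n) 𝕜 ⧸ sl2Block n 𝕜)} (hC : IsCompact C)
    (hcov : ∀ x : SpecialLinearGroup (Fin n) 𝕜 ⧸ sl2Block n 𝕜,
      ∃ γ : Γ, ∃ c ∈ C, (γ : SpecialLinearGroup (Fin n) 𝕜) • c = x) :
    ∃ P : SpecialLinearGroup (Fin n) 𝕜 → Matrix (Fin n) (Fin n) 𝕜,
      Continuous P ∧ (∀ (γ : Γ) g, P ((γ : SpecialLinearGroup (Fin n) 𝕜) * g) = P g) ∧
      (∀ g, ∀ h ∈ sl2Block n 𝕜, P (g * h) = h.1ᴴ * P g * h.1) ∧ ∀ g, (P g).PosDef := by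
  obtain ⟨β, hβ1, hβc, -, hβ01⟩ := exists_continuousMap_one_of_isCompact_subset_isOpen hC
    isOpen_univ (Set.subset_univ C)
  let q : SpecialLinearGroup (Fin n) 𝕜 → SpecialLinearGroup (Fin n) 𝕜 ⧸ sl2Block n 𝕜 :=
    QuotientGroup.mk
  have hq : Continuous q := QuotientGroup.continuous_mk
  let T : Γ → SpecialLinearGroup (Fin n) 𝕜 → Matrix (Fin n) (Fin n) 𝕜 := fun γ g =>
    β (q (γ.1 * g)) • ((γ.1 * g).1ᴴ * (γ.1 * g).1)
  have hTc : ∀ γ, Continuous (T γ) := by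
    intro γ
    have h1 : Continuous fun g : SpecialLinearGroup (Fin n) 𝕜 => γ.1 * g := continuous_const_mul _
    have h2 := sl_continuous_coe.comp h1
    exact (β.continuous.comp (hq.comp h1)).smul (h2.matrix_conjTranspose.matrix_mul h2)
  have hTnz : ∀ γ g, T γ g ≠ 0 → q (γ.1 * g) ∈ tsupport β := by
    intro γ g h
    apply subset_tsupport
    intro h0
    apply h
    simp only [T]
    rw [h0, zero_smul]
  have hlf : LocallyFinite fun γ => Function.support (T γ) := by
    intro g
    obtain ⟨K, hK, hKg⟩ := exists_compact_mem_nhds g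
    refine ⟨K, hKg, (hΓ (q '' K) (tsupport β) (hK.image hq) hβc).subset ?_⟩
    rintro γ ⟨x, hx, hxK⟩
    exact ⟨q x, ⟨x, hxK, rfl⟩, hTnz γ x hx⟩
  have hfs : ∀ g, (Function.support fun γ => T γ g).Finite := fun g => hlf.point_finite g
  have hps : ∀ γ g, (T γ g).PosSemidef := by
    intro γ g
    exact (posSemidef_conjTranspose_mul_self _).smul (hβ01 _).1
  refine ⟨fun g => ∑ᶠ γ, T γ g, continuous_finsum hTc hlf, ?_, ?_, ?_⟩
  · intro γ g
    change ∑ᶠ γ', T γ' (γ.1 * g) = ∑ᶠ γ', T γ' g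
    rw [← finsum_comp_equiv (Equiv.mulRight γ) (f := fun γ' => T γ' g)]
    refine finsum_congr fun γ' => ?_
    simp only [T, Equiv.coe_mulRight, Subgroup.coe_mul, mul_assoc]
  · intro g h hh
    have h1 : ∀ γ, T γ (g * h) = h.1ᴴ * T γ g * h.1 := by
      intro γ
      have h2 : q (γ.1 * (g * h)) = q (γ.1 * g) := by
        rw [← mul_assoc]
        exact QuotientGroup.mk_mul_of_mem _ hh
      simp only [T]
      rw [h2, ← mul_assoc, slc_mul (γ.1 * g) h, conjTranspose_mul]
      simp only [mul_smul_comm, smul_mul_assoc, mul_assoc]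
    simp only [h1]
    let L : Matrix (Fin n) (Fin n) 𝕜 →+ Matrix (Fin n) (Fin n) 𝕜 :=
      (AddMonoidHom.mulRight h.1).comp (AddMonoidHom.mulLeft h.1ᴴ)
    exact (L.map_finsum (hfs g)).symm
  · intro g
    have hsum : ∑ᶠ γ, T γ g = ∑ γ ∈ (hfs g).toFinset, T γ g := finsum_eq_sum _ (hfs g)
    obtain ⟨γ, c, hc, he⟩ := hcov (q g)
    have hβ : β (q ((γ⁻¹ : Γ).1 * g)) = 1 := by
      have : q ((γ⁻¹ : Γ).1 * g) = c := by
        change (γ.1⁻¹ : SpecialLinearGroup (Fin n) 𝕜) • q g = c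
        rw [← he, inv_smul_smul]
      rw [this]
      exact hβ1 hc
    have hpd : (T γ⁻¹ g).PosDef := by
      simp only [T]
      rw [hβ, one_smul]
      refine PosDef.conjTranspose_mul_self _ ?_
      refine mulVec_injective_of_isUnit ?_
      rw [isUnit_iff_isUnit_det]
      rw [((γ⁻¹ : Γ).1 * g).2]
      exact isUnit_one
    have hsum2 : ∑ᶠ γ, T γ g = T γ⁻¹ g + ∑ γ' ∈ (hfs g).toFinset.erase γ⁻¹, T γ' g := by
      rw [hsum]
      by_cases hm : γ⁻¹ ∈ (hfs g).toFinset
      · exact (Finset.add_sum_erase _ (fun γ' => T γ' g) hm).symm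
      · have h0 : T γ⁻¹ g = 0 := by
          simpa using hm
        rw [h0, zero_add, Finset.erase_eq_of_notMem hm]
    change (∑ᶠ γ, T γ g).PosDef
    rw [hsum2]
    exact hpd.add_posSemidef (posSemidef_sum _ fun γ' _ => hps γ' g)

end GroupPart3


section GroupPart4

open Matrix Pointwise ComplexOrder

variable {𝕜 : Type*} [RCLike 𝕜] {m : ℕ}

lemma eq_i0_or_i1 {k : Fin (m + 4)} (hk : ¬ 2 ≤ (k : ℕ)) : k = i0 ∨ k = i1 := by
  simp only [i0, i1, Fin.ext_iff]
  omega

lemma sum_block (f : Fin (m + 4) → 𝕜) (hf : ∀ k : Fin (m + 4), 2 ≤ (k : ℕ) → f k = 0) :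
    ∑ k, f k = f i0 + f i1 := by
  rw [← Finset.sum_pair (i01 (m := m))]
  symm
  refine Finset.sum_subset (Finset.subset_univ _) fun k _ hk => hf k ?_
  by_contra h
  rcases eq_i0_or_i1 h with rfl | rfl <;> simp at hk

lemma block_lt {i k : Fin (m + 4)} (hi : i = i0 ∨ i = i1) (hk : 2 ≤ (k : ℕ)) : k ≠ i := by
  rintro rfl
  rcases hi with rfl | rfl <;> simp [i0, i1] at hk

lemma conj_entry {A X : Matrix (Fin (m + 4)) (Fin (m + 4)) 𝕜} (hA : Pblock A) {i j : Fin (m + 4)}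
    (hi : i = i0 ∨ i = i1) (hj : j = i0 ∨ j = i1) :
    (Aᴴ * X * A) i j = (star (A i0 i) * X i0 i0 + star (A i1 i) * X i1 i0) * A i0 j
      + (star (A i0 i) * X i0 i1 + star (A i1 i) * X i1 i1) * A i1 j := by
  have h1 : ∀ l, (Aᴴ * X) i l = star (A i0 i) * X i0 l + star (A i1 i) * X i1 l := by
    intro l
    rw [Matrix.mul_apply, sum_block]
    · simp [conjTranspose_apply]
    · intro k hk
      rw [conjTranspose_apply, hA k i (Or.inl hk), if_neg (block_lt hi hk)]
      simp
  rw [Matrix.mul_apply, sum_block]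
  · rw [h1, h1]
  · intro k hk
    rw [hA k j (Or.inl hk), if_neg (block_lt hj hk), mul_zero]

lemma det_Pblock {A : Matrix (Fin (m + 4)) (Fin (m + 4)) 𝕜} (hA : Pblock A) :
    A.det = A i0 i0 * A i1 i1 - A i0 i1 * A i1 i0 := by
  rw [twoBlockTriangular_det' A (fun i => (i : ℕ) < 2)]
  · have h2 : (toSquareBlockProp A fun i => ¬ (i : ℕ) < 2) = 1 := by
      ext i j
      have hi : 2 ≤ (i.1 : ℕ) := not_lt.mp i.2
      change A i.1 j.1 = _
      rw [hA _ _ (Or.inl hi), Matrix.one_apply]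
      simp [Subtype.ext_iff]
    rw [h2, det_one, mul_one]
    let e : Fin 2 ≃ {i : Fin (m + 4) // (i : ℕ) < 2} :=
      { toFun := fun i => ⟨⟨i, by omega⟩, i.2⟩
        invFun := fun i => ⟨i.1, i.2⟩
        left_inv := fun i => rfl
        right_inv := fun i => rfl }
    rw [← det_submatrix_equiv_self e, det_fin_two]
    rfl
  · intro i hi j hj
    have hj' : 2 ≤ (j : ℕ) := not_lt.mp hj
    rw [hA i j (Or.inr hj'), if_neg]
    rintro rfl
    exact hj hi

/-- The determinant of the upper-left block. -/
def dblock (X : Matrix (Fin (m + 4)) (Fin (m + 4)) 𝕜) : 𝕜 :=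
  X i0 i0 * X i1 i1 - X i0 i1 * X i1 i0

lemma dblock_ne_zero {X : Matrix (Fin (m + 4)) (Fin (m + 4)) 𝕜} (hX : X.PosDef) :
    dblock X ≠ 0 := by
  have hinj : Function.Injective ![(i0 : Fin (m + 4)), i1] := by
    intro a b
    fin_cases a <;> fin_cases b <;> simp [i01, i10]
  have h := (hX.submatrix hinj).det_pos
  rw [det_fin_two] at h
  exact h.ne'

lemma dblock_conj {A X : Matrix (Fin (m + 4)) (Fin (m + 4)) 𝕜} (hA : Pblock A) (hd : A.det = 1) :
    dblock (Aᴴ * X * A) = dblock X := by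
  rw [det_Pblock hA] at hd
  have hd' := congrArg star hd
  simp only [star_sub, star_mul', star_one] at hd'
  have h0 : (i0 : Fin (m + 4)) = i0 ∨ (i0 : Fin (m + 4)) = i1 := Or.inl rfl
  have h1 : (i1 : Fin (m + 4)) = i0 ∨ (i1 : Fin (m + 4)) = i1 := Or.inr rfl
  unfold dblock
  rw [conj_entry hA h0 h0, conj_entry hA h0 h1, conj_entry hA h1 h0, conj_entry hA h1 h1]
  generalize star (A i0 i0) = a at *
  generalize star (A i0 i1) = b at *
  generalize star (A i1 i0) = c at *
  generalize star (A i1 i1) = d at *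
  calc _ = (a * d - b * c) * (A i0 i0 * A i1 i1 - A i0 i1 * A i1 i0) *
      (X i0 i0 * X i1 i1 - X i0 i1 * X i1 i0) := by ring
    _ = _ := by rw [hd, hd']; ring

lemma posDef_diag_re {n : ℕ} {X : Matrix (Fin n) (Fin n) 𝕜} (hX : X.PosDef) (i : Fin n) :
    0 < RCLike.re (X i i) ∧ X i i = ((RCLike.re (X i i) : ℝ) : 𝕜) := by
  have h := RCLike.pos_iff.mp (hX.diag_pos (i := i))
  refine ⟨h.1, ?_⟩
  apply RCLike.ext
  · simp
  · simp [h.2]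

lemma le_one_add_of_sq_le {x y : ℝ} (h : x ^ 2 ≤ y) : x ≤ 1 + y := by
  nlinarith [sq_nonneg (x - 1)]

variable {Γ : Subgroup (SpecialLinearGroup (Fin (m + 4)) 𝕜)}
  {P : SpecialLinearGroup (Fin (m + 4)) 𝕜 → Matrix (Fin (m + 4)) (Fin (m + 4)) 𝕜}

lemma exists_N1 {C : Set (SpecialLinearGroup (Fin (m + 4)) 𝕜 ⧸ sl2Block (m + 4) 𝕜)}
    (hC : IsCompact C)
    (hcov : ∀ x : SpecialLinearGroup (Fin (m + 4)) 𝕜 ⧸ sl2Block (m + 4) 𝕜,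
      ∃ γ : Γ, ∃ c ∈ C, (γ : SpecialLinearGroup (Fin (m + 4)) 𝕜) • c = x)
    (hPc : Continuous P)
    (hPΓ : ∀ (γ : Γ) g, P ((γ : SpecialLinearGroup (Fin (m + 4)) 𝕜) * g) = P g)
    (hPH : ∀ g, ∀ h ∈ sl2Block (m + 4) 𝕜, P (g * h) = h.1ᴴ * P g * h.1)
    (hPpos : ∀ g, (P g).PosDef) :
    ∃ D : Set (SpecialLinearGroup (Fin (m + 4)) 𝕜), IsCompact D ∧
      ∀ g, P g i0 i0 = 1 → P g i0 i1 = 0 →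
        ∃ γ : Γ, ∃ d ∈ D, g = (γ : SpecialLinearGroup (Fin (m + 4)) 𝕜) * d := by
  obtain ⟨D0, hD0, hlift⟩ := exists_compact_lift hC
  have hent : ∀ i j, Continuous fun g => P g i j := fun i j => hPc.matrix_elem i j
  have hdc : Continuous fun g => (dblock (P g))⁻¹ := by
    refine Continuous.inv₀ ?_ fun g => dblock_ne_zero (hPpos g)
    unfold dblock
    exact ((hent _ _).mul (hent _ _)).sub ((hent _ _).mul (hent _ _))
  obtain ⟨B0, hB0⟩ := hD0.exists_bound_of_continuousOn (hent i0 i0).continuousOn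
  obtain ⟨B1, hB1⟩ := hD0.exists_bound_of_continuousOn (hent i1 i1).continuousOn
  obtain ⟨S, hS⟩ := hD0.exists_bound_of_continuousOn hdc.continuousOn
  set B := |B0| + |B1| with hB
  have hBn : 0 ≤ B := by positivity
  refine ⟨D0 * (bddSL (m + 4) 𝕜 (1 + (B + |S| * B)))⁻¹, hD0.mul (isCompact_bddSL _).inv, ?_⟩
  intro g hg0 hg1
  obtain ⟨γ, c, hc, he⟩ := hcov (QuotientGroup.mk g)
  obtain ⟨d, hd, rfl⟩ := hlift c hc
  have he' : (QuotientGroup.mk g : SpecialLinearGroup (Fin (m + 4)) 𝕜 ⧸ sl2Block (m + 4) 𝕜) =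
    QuotientGroup.mk (γ.1 * d) := he.symm
  rw [QuotientGroup.eq] at he'
  set k := g⁻¹ * (γ.1 * d) with hk
  have hgk : g = γ.1 * (d * k⁻¹) := by rw [hk]; group
  refine ⟨γ, d * k⁻¹, Set.mul_mem_mul hd (Set.inv_mem_inv.mpr ?_), hgk⟩
  have hPd : P d = k.1ᴴ * P g * k.1 := by
    rw [← hPH g k he', ← hPΓ γ d, hk]
    congr 1
    group
  have hkP : Pblock k.1 := he'
  have hdb : dblock (P d) = P g i1 i1 := by
    rw [hPd, dblock_conj hkP k.2, dblock, hg0, hg1]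
    ring
  have hg1' : P g i1 i0 = 0 := by
    rw [← (hPpos g).isHermitian.apply i1 i0, hg1, star_zero]
  obtain ⟨hσ, hσe⟩ := posDef_diag_re (hPpos g) i1
  set σ := RCLike.re (P g i1 i1) with hσdef
  have hσS : σ⁻¹ ≤ |S| := by
    have := hS d hd
    rw [hdb, hσe, norm_inv, RCLike.norm_ofReal, abs_of_pos hσ] at this
    exact this.trans (le_abs_self S)
  have key : ∀ j : Fin (m + 4), (j = i0 ∨ j = i1) →
      ‖k.1 i0 j‖ ^ 2 + σ * ‖k.1 i1 j‖ ^ 2 ≤ B := by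
    intro j hj
    have h1 : P d j j = ((‖k.1 i0 j‖ ^ 2 + σ * ‖k.1 i1 j‖ ^ 2 : ℝ) : 𝕜) := by
      rw [hPd, conj_entry hkP hj hj, hg0, hg1, hg1', hσe]
      push_cast
      rw [← RCLike.conj_mul, ← RCLike.conj_mul]
      simp only [RCLike.star_def]
      ring
    have h2 : ‖P d j j‖ ≤ B := by
      rcases hj with rfl | rfl
      · refine (hB0 d hd).trans ?_
        have := le_abs_self B0
        have := abs_nonneg B1
        linarith
      · refine (hB1 d hd).trans ?_
        have := le_abs_self B1
        have := abs_nonneg B0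
        linarith
    rw [h1, RCLike.norm_ofReal] at h2
    exact (le_abs_self _).trans h2
  have hb0 : ∀ j : Fin (m + 4), (j = i0 ∨ j = i1) → ‖k.1 i0 j‖ ≤ 1 + (B + |S| * B) := by
    intro j hj
    apply le_one_add_of_sq_le
    have h1 := key j hj
    have h2 : 0 ≤ σ * ‖k.1 i1 j‖ ^ 2 := by positivity
    have h3 : 0 ≤ |S| * B := by positivity
    linarith
  have hb1 : ∀ j : Fin (m + 4), (j = i0 ∨ j = i1) → ‖k.1 i1 j‖ ≤ 1 + (B + |S| * B) := by
    intro j hj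
    apply le_one_add_of_sq_le
    have h1 := key j hj
    have h2 : σ * ‖k.1 i1 j‖ ^ 2 ≤ B := by
      have : 0 ≤ ‖k.1 i0 j‖ ^ 2 := by positivity
      linarith
    calc ‖k.1 i1 j‖ ^ 2 = σ⁻¹ * (σ * ‖k.1 i1 j‖ ^ 2) := by field_simp
      _ ≤ |S| * B := mul_le_mul hσS h2 (by positivity) (abs_nonneg S)
      _ ≤ _ := by linarith
  have h1n : (1 : ℝ) ≤ 1 + (B + |S| * B) := by
    have : 0 ≤ B + |S| * B := by positivity
    linarith
  intro i j
  by_cases hij : 2 ≤ (i : ℕ) ∨ 2 ≤ (j : ℕ)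
  · change ‖k.1 i j‖ ≤ _
    rw [hkP i j hij]
    split_ifs
    · simpa using h1n
    · rw [norm_zero]; linarith
  · rw [not_or] at hij
    rcases eq_i0_or_i1 hij.1 with rfl | rfl
    · exact hb0 j (eq_i0_or_i1 hij.2)
    · exact hb1 j (eq_i0_or_i1 hij.2)

/-- Upper triangular block matrices. -/
def bM (a z : 𝕜) : Matrix (Fin (m + 4)) (Fin (m + 4)) 𝕜 := fun i j =>
  if i = i0 ∧ j = i0 then a else if i = i0 ∧ j = i1 then z else
    if i = i1 ∧ j = i1 then a⁻¹ else if i = j then 1 else 0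

lemma bM_Pblock (a z : 𝕜) : Pblock (bM a z : Matrix (Fin (m + 4)) (Fin (m + 4)) 𝕜) := by
  intro i j hij
  unfold bM
  rw [if_neg, if_neg, if_neg]
  · rintro ⟨rfl, rfl⟩; simp [i1] at hij
  · rintro ⟨rfl, rfl⟩; simp [i0, i1] at hij
  · rintro ⟨rfl, rfl⟩; simp [i0] at hij

lemma bM00 (a z : 𝕜) : (bM a z : Matrix (Fin (m + 4)) (Fin (m + 4)) 𝕜) i0 i0 = a := by
  simp [bM]
lemma bM01 (a z : 𝕜) : (bM a z : Matrix (Fin (m + 4)) (Fin (m + 4)) 𝕜) i0 i1 = z := by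
  simp [bM, i10]
lemma bM10 (a z : 𝕜) : (bM a z : Matrix (Fin (m + 4)) (Fin (m + 4)) 𝕜) i1 i0 = 0 := by
  simp [bM, i10, i01]
lemma bM11 (a z : 𝕜) : (bM a z : Matrix (Fin (m + 4)) (Fin (m + 4)) 𝕜) i1 i1 = a⁻¹ := by
  simp [bM, i10]

/-- Upper triangular elements of the block subgroup. -/
def bG (a z : 𝕜) (ha : a ≠ 0) : SpecialLinearGroup (Fin (m + 4)) 𝕜 :=
  ⟨bM a z, by rw [det_Pblock (bM_Pblock a z), bM00, bM01, bM10, bM11]; field_simp; simp⟩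

lemma bG_mem (a z : 𝕜) (ha : a ≠ 0) : bG a z ha ∈ sl2Block (m + 4) 𝕜 := bM_Pblock a z

lemma continuous_bG {X : Type*} [TopologicalSpace X] (a z : X → 𝕜) (ha : ∀ x, a x ≠ 0)
    (hac : Continuous a) (hzc : Continuous z) :
    Continuous fun x => (bG (a x) (z x) (ha x) : SpecialLinearGroup (Fin (m + 4)) 𝕜) := by
  rw [sl_isClosedEmbedding.isEmbedding.continuous_iff]
  refine continuous_matrix fun i j => ?_
  change Continuous fun x => (bM (a x) (z x) : Matrix (Fin (m + 4)) (Fin (m + 4)) 𝕜) i j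
  unfold bM
  split_ifs
  · exact hac
  · exact hzc
  · exact hac.inv₀ ha
  · exact continuous_const
  · exact continuous_const

/-- The map to the parameters of the upper-left block. -/
def phi (P : SpecialLinearGroup (Fin (m + 4)) 𝕜 → Matrix (Fin (m + 4)) (Fin (m + 4)) 𝕜)
    (g : SpecialLinearGroup (Fin (m + 4)) 𝕜) : ℝ × 𝕜 :=
  (Real.log (RCLike.re (P g i0 i0)), P g i0 i1 / P g i0 i0)

lemma continuous_phi (hPc : Continuous P) (hPpos : ∀ g, (P g).PosDef) : Continuous (phi P) := by
  have hent : ∀ i j, Continuous fun g => P g i j := fun i j => hPc.matrix_elem i j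
  refine Continuous.prodMk ?_ ?_
  · exact (RCLike.continuous_re.comp (hent _ _)).log fun g => (posDef_diag_re (hPpos g) i0).1.ne'
  · exact (hent _ _).div (hent _ _) fun g => (hPpos g).diag_pos.ne'

lemma phi_eq_zero (hPpos : ∀ g, (P g).PosDef) {g : SpecialLinearGroup (Fin (m + 4)) 𝕜}
    (h : phi P g = 0) : P g i0 i0 = 1 ∧ P g i0 i1 = 0 := by
  obtain ⟨h1, h2⟩ := posDef_diag_re (hPpos g) i0
  have ha : Real.log (RCLike.re (P g i0 i0)) = 0 := congrArg Prod.fst h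
  have hb : P g i0 i1 / P g i0 i0 = 0 := congrArg Prod.snd h
  have hc : RCLike.re (P g i0 i0) = 1 := by
    rw [← Real.exp_log h1, ha, Real.exp_zero]
  have hd : P g i0 i0 = 1 := by rw [h2, hc]; simp
  refine ⟨hd, ?_⟩
  rwa [hd, div_one] at hb

lemma exists_section
    (hPH : ∀ g, ∀ h ∈ sl2Block (m + 4) 𝕜, P (g * h) = h.1ᴴ * P g * h.1)
    (hPpos : ∀ g, (P g).PosDef) :
    ∃ b : ℝ × 𝕜 → SpecialLinearGroup (Fin (m + 4)) 𝕜, Continuous b ∧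
      (∀ y, b y ∈ sl2Block (m + 4) 𝕜) ∧ ∀ y, phi P (b y) = y := by
  obtain ⟨hp, hpe⟩ := posDef_diag_re (hPpos 1) i0
  set p := RCLike.re (P 1 i0 i0) with hpdef
  set q := P 1 i0 i1 with hq
  let a : ℝ × 𝕜 → ℝ := fun y => Real.sqrt (Real.exp y.1 / p)
  have ha : ∀ y, 0 < a y := fun y => Real.sqrt_pos.mpr (by positivity)
  have ha2 : ∀ y, a y * a y * p = Real.exp y.1 := by
    intro y
    rw [Real.mul_self_sqrt (by positivity)]
    field_simp
  have hac : Continuous a := by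
    refine Real.continuous_sqrt.comp ?_
    exact (Real.continuous_exp.comp continuous_fst).div_const p
  have hak : ∀ y, ((a y : ℝ) : 𝕜) ≠ 0 := fun y => RCLike.ofReal_ne_zero.mpr (ha y).ne'
  have hpk : ((p : ℝ) : 𝕜) ≠ 0 := RCLike.ofReal_ne_zero.mpr hp.ne'
  let z : ℝ × 𝕜 → 𝕜 := fun y => (y.2 * ((Real.exp y.1 : ℝ) : 𝕜) - q) / ((a y : ℝ) * (p : ℝ))
  have hack : Continuous fun y => ((a y : ℝ) : 𝕜) := RCLike.continuous_ofReal.comp hac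
  have hzc : Continuous z := by
    refine Continuous.div ?_ (hack.mul continuous_const) fun y => mul_ne_zero (hak y) hpk
    refine (continuous_snd.mul ?_).sub continuous_const
    exact RCLike.continuous_ofReal.comp (Real.continuous_exp.comp continuous_fst)
  refine ⟨fun y => bG ((a y : ℝ) : 𝕜) (z y) (hak y), continuous_bG _ _ hak hack hzc,
    fun y => bG_mem _ _ _, fun y => ?_⟩
  have hPb : P (bG ((a y : ℝ) : 𝕜) (z y) (hak y)) =
      (bM ((a y : ℝ) : 𝕜) (z y))ᴴ * P 1 * bM ((a y : ℝ) : 𝕜) (z y) := by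
    have := hPH 1 _ (bG_mem ((a y : ℝ) : 𝕜) (z y) (hak y))
    rwa [one_mul] at this
  have hexp : ((Real.exp y.1 : ℝ) : 𝕜) = (a y : ℝ) * (a y : ℝ) * (p : ℝ) := by
    rw [← ha2 y]; push_cast; rfl
  have h00 : P (bG ((a y : ℝ) : 𝕜) (z y) (hak y)) i0 i0 = ((Real.exp y.1 : ℝ) : 𝕜) := by
    rw [hPb, conj_entry (bM_Pblock _ _) (Or.inl rfl) (Or.inl rfl), bM00, bM10, hpe, hexp]
    simp only [RCLike.star_def, RCLike.conj_ofReal, map_zero]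
    ring
  have h01 : P (bG ((a y : ℝ) : 𝕜) (z y) (hak y)) i0 i1 = y.2 * ((Real.exp y.1 : ℝ) : 𝕜) := by
    rw [hPb, conj_entry (bM_Pblock _ _) (Or.inl rfl) (Or.inr rfl), bM00, bM10, bM01, bM11, hpe,
      ← hq]
    simp only [RCLike.star_def, RCLike.conj_ofReal, map_zero, z]
    have := hak y
    field_simp
    ring
  have hek : ((Real.exp y.1 : ℝ) : 𝕜) ≠ 0 := RCLike.ofReal_ne_zero.mpr (Real.exp_pos _).ne'
  unfold phi
  rw [h00, h01, mul_div_cancel_right₀ _ hek, RCLike.ofReal_re, Real.log_exp]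

theorem main_aux (Γ : Subgroup (SpecialLinearGroup (Fin (m + 4)) 𝕜)) (hΓ : PDisc Γ)
    {C : Set (SpecialLinearGroup (Fin (m + 4)) 𝕜 ⧸ sl2Block (m + 4) 𝕜)}
    (hC : IsCompact C)
    (hcov : ∀ x : SpecialLinearGroup (Fin (m + 4)) 𝕜 ⧸ sl2Block (m + 4) 𝕜,
      ∃ γ : Γ, ∃ c ∈ C, (γ : SpecialLinearGroup (Fin (m + 4)) 𝕜) • c = x) : False := by
  obtain ⟨P, hPc, hPΓ, hPH, hPpos⟩ := exists_P hΓ hC hcov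
  obtain ⟨D, hD, hN⟩ := exists_N1 hC hcov hPc hPΓ hPH hPpos
  obtain ⟨b, hbc, hbH, hb⟩ := exists_section hPH hPpos
  have hphi := continuous_phi hPc hPpos
  have hN' : ∀ y v, phi P (b y * ell v) = 0 → ∃ γ : Γ, ∃ d ∈ D,
      b y * ell v = (γ : SpecialLinearGroup (Fin (m + 4)) 𝕜) * d := by
    intro y v h
    obtain ⟨h1, h2⟩ := phi_eq_zero hPpos h
    exact hN _ h1 h2
  have hdim : Module.finrank ℝ (ℝ × 𝕜) < Module.finrank ℝ (Fin 3 → 𝕜) := by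
    rw [Module.finrank_prod, Module.finrank_pi_fintype]
    have : 0 < Module.finrank ℝ 𝕜 := Module.finrank_pos
    simp
    omega
  obtain ⟨M, hM⟩ := prop_lemma hΓ hD hD
  refine no_proper_family hdim (fun y v => phi P (b y * ell v)) ?_ ?_ M ?_ ?_ ?_
  · exact hphi.comp ((hbc.comp continuous_fst).mul (continuous_ell.comp continuous_snd))
  · intro y
    simp only [ell_zero, mul_one, hb]
  · intro y v v' h h'
    obtain ⟨γ, d, hd, e⟩ := hN' y v h
    obtain ⟨γ', d', hd', e'⟩ := hN' y v' h'
    refine hM (v' - v) (γ⁻¹ * γ') d hd d' hd' ?_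
    have h1 : (ell v' : SpecialLinearGroup (Fin (m + 4)) 𝕜) = ell v * ell (v' - v) := by
      rw [← ell_add]; congr 1; abel
    rw [h1, ← mul_assoc, e] at e'
    rw [Subgroup.coe_mul, Subgroup.coe_inv, mul_assoc, ← e']
    group
  · intro ρ
    have hL : IsCompact (D * (ell '' Metric.closedBall (0 : Fin 3 → 𝕜) ρ)⁻¹ :
        Set (SpecialLinearGroup (Fin (m + 4)) 𝕜)) :=
      hD.mul ((isCompact_closedBall _ _).image continuous_ell).inv
    set L := (D * (ell '' Metric.closedBall (0 : Fin 3 → 𝕜) ρ)⁻¹ :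
        Set (SpecialLinearGroup (Fin (m + 4)) 𝕜)) with hLdef
    have hfin := hΓ.finite hL (isCompact_singleton (x := 1))
    have hcomp := hfin.isCompact_biUnion
      (f := fun γ : Γ => {(γ : SpecialLinearGroup (Fin (m + 4)) 𝕜)} * L)
      fun γ _ => isCompact_singleton.mul hL
    obtain ⟨R, hR⟩ := hcomp.exists_bound_of_continuousOn hphi.continuousOn
    refine ⟨R, fun y v h hv => ?_⟩
    obtain ⟨γ, d, hd, e⟩ := hN' y v h
    have hmem : d * (ell v)⁻¹ ∈ L := Set.mul_mem_mul hd
      (Set.inv_mem_inv.mpr ⟨v, mem_closedBall_zero_iff.mpr hv, rfl⟩)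
    have hby : b y = (γ : SpecialLinearGroup (Fin (m + 4)) 𝕜) * (d * (ell v)⁻¹) := by
      rw [← mul_assoc, ← e]; group
    have := hR (b y) (Set.mem_iUnion₂.mpr ⟨γ, ⟨_, hmem, 1, rfl, (b y)⁻¹, inv_mem (hbH y), ?_⟩, ?_⟩)
    · rwa [hb] at this
    · rw [← hby]; group
    · rw [hby]
      exact Set.mul_mem_mul rfl hmem
  · intro ρ
    obtain ⟨R, hR⟩ := prop_lemma hΓ ((isCompact_closedBall (0 : ℝ × 𝕜) ρ).image hbc) hD
    refine ⟨R, fun y v hy h => ?_⟩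
    obtain ⟨γ, d, hd, e⟩ := hN' y v h
    exact hR v γ (b y) ⟨y, mem_closedBall_zero_iff.mpr hy, rfl⟩ d hd e

end GroupPart4

/-- **Corollary to Theorem 1.7.** For `n ≥ 4`, the homogeneous space
`SL(n,ℝ)/SL(2,ℝ)` (and likewise over `ℂ`) admits no compact quotient: no discrete
subgroup `Γ ≤ SL(n,ℝ)` acts properly discontinuously and cocompactly on it. -/
theorem no_compact_quotient_SLn_mod_SL2
    {𝕜 : Type*} [RCLike 𝕜] {n : ℕ} (hn : 4 ≤ n) :
    ¬ ∃ Γ : Subgroup (Matrix.SpecialLinearGroup (Fin n) 𝕜),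
      DiscreteTopology ↥Γ ∧
      (∀ A B : Set (Matrix.SpecialLinearGroup (Fin n) 𝕜 ⧸ sl2Block n 𝕜),
        IsCompact A → IsCompact B →
        {γ : Γ | ∃ x ∈ A, (γ : Matrix.SpecialLinearGroup (Fin n) 𝕜) • x ∈ B}.Finite) ∧
      (∃ C : Set (Matrix.SpecialLinearGroup (Fin n) 𝕜 ⧸ sl2Block n 𝕜),
        IsCompact C ∧ ∀ x : Matrix.SpecialLinearGroup (Fin n) 𝕜 ⧸ sl2Block n 𝕜,
          ∃ γ : Γ, ∃ c ∈ C, (γ : Matrix.SpecialLinearGroup (Fin n) 𝕜) • c = x) := by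
  rintro ⟨Γ, -, hΓ, C, hC, hcov⟩
  obtain ⟨m, rfl⟩ := Nat.exists_eq_add_of_le' hn
  exact main_aux Γ hΓ hC hcov

end
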